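/- arXiv:math/0403211 — 2 statements merged into one kernel-verified Lean document; each statement's English description precedes it below -/
import Mathlib

section
/- Let S ≥ 1 be an integer and let → be a relation on {1, …, S} such that j → i implies i < j. Let a : {1, …, S} → ℝ be a nonnegative function compatible with the graph structure, i.e. a(i) ≥ Σ_{j : j → i} a(j) for every i. Suppose given nonnegative real numbers M_i, F_i, d_i (for 1 ≤ i ≤ S), nonnegative reals m_{i,j} (for 1 ≤ i < j ≤ S), and a real c ≥ 0, such that: (1) M_i + d_i = F_i + Σ_{i' < i} m_{i',i} for every i; (2) m_{i,j} ≤ d_i whenever i < j; (3) m_{i,j} > 0 only if j → i; and (4) d_S ≥ c. Then Σ_{i=1}^{S} a(i)·F_i ≥ Σ_{i=1}^{S} a(i)·M_i + a(S)·c. -/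
open Finset

/-- If `w` is at most `δ` on `u ⊆ s`, and positive there only where `p` holds, then its
`a`-weighted sum over `u` is at most `α * δ` for any `α` bounding the total weight of
`{j ∈ s | p j}`. -/
lemma sum_mul_le_of_weight_le {ι : Type*} {s u : Finset ι} (p : ι → Prop) [DecidablePred p]
    {a w : ι → ℝ} {α δ : ℝ} (hus : u ⊆ s) (ha : ∀ j ∈ s, 0 ≤ a j) (hδ : 0 ≤ δ)
    (hw : ∀ j ∈ u, w j ≤ δ) (hp : ∀ j ∈ u, 0 < w j → p j) (hα : ∑ j ∈ s with p j, a j ≤ α) :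
    ∑ j ∈ u, a j * w j ≤ α * δ := by
  calc ∑ j ∈ u, a j * w j ≤ ∑ j ∈ u, if p j then a j * δ else 0 := by
        refine sum_le_sum fun j hj => ?_
        have haj := ha j (hus hj)
        split_ifs with h
        · exact mul_le_mul_of_nonneg_left (hw j hj) haj
        · exact mul_nonpos_of_nonneg_of_nonpos haj (not_lt.mp (mt (hp j hj) h))
    _ ≤ ∑ j ∈ s, if p j then a j * δ else 0 := by
        refine sum_le_sum_of_subset_of_nonneg hus fun j hj _ => ?_
        have haj := ha j hj
        split_ifs <;> positivity
    _ = (∑ j ∈ s with p j, a j) * δ := by rw [← sum_filter, sum_mul]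
    _ ≤ α * δ := mul_le_mul_of_nonneg_right hα hδ

/-- Combinatorial content of Proposition 2.2 (inequality (b8)): on the index
set `{1, …, S}` with an arrow relation `arr` going from larger to smaller
indices, for a nonnegative function `a` compatible with the graph structure
and data `M, F, d, m, c` satisfying the counting-of-multiplicities relations
(1)–(4), one has `Σ a(i)·F(i) ≥ Σ a(i)·M(i) + a(S)·c`. -/
theorem stmt_5 (S : ℕ) (hS : 1 ≤ S) (arr : ℕ → ℕ → Prop)
    [DecidableRel arr]
    (harr : ∀ j ∈ Icc 1 S, ∀ i ∈ Icc 1 S, arr j i → i < j)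
    (a M F d : ℕ → ℝ) (m : ℕ → ℕ → ℝ) (c : ℝ)
    (ha : ∀ i ∈ Icc 1 S, 0 ≤ a i)
    (hcompat : ∀ i ∈ Icc 1 S,
      (∑ j ∈ (Icc 1 S).filter (fun j => arr j i), a j) ≤ a i)
    (hM : ∀ i ∈ Icc 1 S, 0 ≤ M i)
    (hF : ∀ i ∈ Icc 1 S, 0 ≤ F i)
    (hd : ∀ i ∈ Icc 1 S, 0 ≤ d i)
    (hm : ∀ i ∈ Icc 1 S, ∀ j ∈ Icc 1 S, i < j → 0 ≤ m i j)
    (hc : 0 ≤ c)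
    (h1 : ∀ i ∈ Icc 1 S, M i + d i = F i + ∑ i' ∈ Ico 1 i, m i' i)
    (h2 : ∀ i ∈ Icc 1 S, ∀ j ∈ Icc 1 S, i < j → m i j ≤ d i)
    (h3 : ∀ i ∈ Icc 1 S, ∀ j ∈ Icc 1 S, i < j → 0 < m i j → arr j i)
    (h4 : c ≤ d S) :
    ∑ i ∈ Icc 1 S, a i * M i + a S * c ≤ ∑ i ∈ Icc 1 S, a i * F i := by
  have hS' : S ∈ Icc 1 S := by simp [hS]
  have hswap : ∑ j ∈ Icc 1 S, ∑ i ∈ Ico 1 j, a j * m i j =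
      ∑ i ∈ Icc 1 S, ∑ j ∈ Ioc i S, a j * m i j :=
    sum_comm' fun j i => by simp only [mem_Icc, mem_Ico, mem_Ioc]; omega
  have hlocal : ∀ i ∈ Icc 1 S,
      (if i = S then a S * c else 0) ≤ a i * d i - ∑ j ∈ Ioc i S, a j * m i j := by
    intro i hi
    split_ifs with h
    · subst h
      simpa using mul_le_mul_of_nonneg_left h4 (ha i hi)
    · have hmem : ∀ j ∈ Ioc i S, j ∈ Icc 1 S ∧ i < j := fun j hj => by
        simp only [mem_Icc, mem_Ioc] at *; omega
      exact sub_nonneg.mpr <| sum_mul_le_of_weight_le (fun j => arr j i)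
        (fun j hj => (hmem j hj).1) ha (hd i hi)
        (fun j hj => h2 i hi j (hmem j hj).1 (hmem j hj).2)
        (fun j hj => h3 i hi j (hmem j hj).1 (hmem j hj).2) (hcompat i hi)
  have hsum := sum_le_sum hlocal
  rw [sum_ite_eq' (Icc 1 S) S, if_pos hS', sum_sub_distrib, ← hswap] at hsum
  have hrel : ∑ i ∈ Icc 1 S, a i * M i + ∑ i ∈ Icc 1 S, a i * d i =
      ∑ i ∈ Icc 1 S, a i * F i + ∑ j ∈ Icc 1 S, ∑ i ∈ Ico 1 j, a j * m i j := by
    rw [← sum_add_distrib, ← sum_add_distrib]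
    refine sum_congr rfl fun i hi => ?_
    rw [← mul_sum, ← mul_add, ← mul_add, h1 i hi]
  linarith
end

section
/- Let K be a field, N and k positive natural numbers, and for each i = 1, …, k let l_{i,1}, …, l_{i,a_i} ∈ K[x₁, …, x_N] be polynomials of degree at most 1 such that the degree-one homogeneous parts of the whole collection {l_{i,j}} are linearly independent in the space of linear forms. Fix natural numbers c₁, …, c_k. Suppose that for each i, f_i = (∏_{j=1}^{i−1} l_{j,1}^{c_j + 1}) · g_i(l_{i,1}, …, l_{i,a_i}), where g_i is a polynomial in a_i variables of total degree at most c_i, evaluated at l_{i,1}, …, l_{i,a_i}. If f₁ + f₂ + ⋯ + f_k = 0, then f_i = 0 for every i. In other words, the sum of the subspaces Z_i = (∏_{j<i} l_{j,1}^{c_j+1})·P_{c_i}(l_{i,1}, …, l_{i,a_i}) is direct. -/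
open MvPolynomial

namespace MvPolynomial

variable {K σ τ : Type*} [Field K]

theorem eq_C_add_homogeneousComponent_one {p : MvPolynomial σ K} (hp : p.totalDegree ≤ 1) :
    p = C (coeff 0 p) + homogeneousComponent 1 p := by
  have h : ∑ i ∈ Finset.range 2, homogeneousComponent i p = p := by
    conv_rhs => rw [← sum_homogeneousComponent p]
    refine (Finset.sum_subset (Finset.range_subset_range.mpr (by omega)) fun i _ hi => ?_).symm
    rw [Finset.mem_range] at hi
    exact homogeneousComponent_eq_zero _ _ (by omega)
  simpa [Finset.sum_range_succ] using h.symm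

/-- Affine functions with linearly independent linear parts can be mapped to independent variables
by an algebra homomorphism. -/
theorem exists_algHom_apply_eq_X {l : τ → MvPolynomial σ K}
    (hdeg : ∀ q, (l q).totalDegree ≤ 1)
    (hind : LinearIndependent K fun q => homogeneousComponent 1 (l q)) :
    ∃ φ : MvPolynomial σ K →ₐ[K] MvPolynomial τ K, ∀ q, φ (l q) = X q := by
  obtain ⟨L, hL⟩ := LinearMap.exists_leftInverse_of_injective
    (Finsupp.linearCombination K fun q => homogeneousComponent 1 (l q))
    (LinearMap.ker_eq_bot.mpr hind)
  let T : MvPolynomial σ K →ₗ[K] MvPolynomial τ K :=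
    Finsupp.linearCombination K (X : τ → MvPolynomial τ K) ∘ₗ L
  have hT (q : τ) : T (homogeneousComponent 1 (l q)) = X q := by
    have h := LinearMap.congr_fun hL (Finsupp.single q 1)
    simp only [LinearMap.comp_apply, Finsupp.linearCombination_single, one_smul,
      LinearMap.id_apply] at h
    simp [T, h]
  let φ : MvPolynomial σ K →ₐ[K] MvPolynomial τ K := aeval fun n => T (X n)
  have hφT (p : MvPolynomial σ K) :
      φ (homogeneousComponent 1 p) = T (homogeneousComponent 1 p) := by
    have hmem := homogeneousComponent_mem 1 p
    rw [homogeneousSubmodule_one_eq_span_X] at hmem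
    refine LinearMap.eqOn_span (f := φ.toLinearMap) (g := T) ?_ hmem
    rintro _ ⟨n, rfl⟩
    simp [φ]
  refine ⟨(aeval fun q => X q - C (coeff 0 (l q))).comp φ, fun q => ?_⟩
  have hq : φ (l q) = C (coeff 0 (l q)) + X q := by
    conv_lhs => rw [eq_C_add_homogeneousComponent_one (hdeg q)]
    rw [map_add, hφT, hT, ← algebraMap_eq, AlgHom.commutes, algebraMap_eq]
  rw [AlgHom.comp_apply, hq, map_add, aeval_X, aeval_C, algebraMap_eq, add_sub_cancel]

theorem eq_zero_of_sum_eq_zero_of_disjoint_support {ι : Type*} [Fintype ι]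
    {F : ι → MvPolynomial σ K} (hdisj : Pairwise fun i j => Disjoint (F i).support (F j).support)
    (hsum : ∑ i, F i = 0) (i : ι) : F i = 0 := by
  ext m
  by_contra hm
  have hm' : m ∈ (F i).support := mem_support_iff.mpr (by simpa using hm)
  have h := congrArg (coeff m) hsum
  rw [coeff_sum, Finset.sum_eq_single i] at h
  · exact hm (by simpa using h)
  · intro j _ hj
    exact notMem_support_iff.mp (Finset.disjoint_left.mp (hdisj hj.symm) hm')
  · simp

theorem disjoint_support_monomial_mul {s t : σ →₀ ℕ} {p q : MvPolynomial σ K} (x : σ)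
    (h : s x + p.totalDegree < t x) :
    Disjoint (monomial s 1 * p).support (monomial t 1 * q).support := by
  refine Finset.disjoint_left.mpr fun m hp hq => ?_
  rw [mem_support_iff, coeff_monomial_mul', one_mul, ite_ne_right_iff] at hp hq
  have hle := (monomial_le_degreeOf x (mem_support_iff.mpr hp.2)).trans
    (degreeOf_le_totalDegree p x)
  have ht := hq.1 x
  rw [Finsupp.tsub_apply] at hle
  omega

end MvPolynomial

/-- Directness of the sum `Z = Σ_i (∏_{j<i} l_{j,1}^{c_j+1})·P_{c_i}(l_{i,1},
…, l_{i,a_i})` from formula (c10) in the proof of Lemma 3.5: if the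
degree-one homogeneous parts of the affine functions `l_{i,j}` are linearly
independent and each `f_i` is of the form
`(∏_{j<i} l_{j,1}^{c_j+1})·g_i(l_{i,1}, …, l_{i,a_i})` with `deg g_i ≤ c_i`,
then `f₁ + ⋯ + f_k = 0` forces every `f_i = 0`. -/
theorem stmt_10 {K : Type*} [Field K] (N k : ℕ) (hN : 0 < N) (hk : 0 < k)
    (a : Fin k → ℕ) (ha : ∀ i, 0 < a i)
    (l : (i : Fin k) → Fin (a i) → MvPolynomial (Fin N) K)
    (hdeg : ∀ i j, (l i j).totalDegree ≤ 1)
    (hind : LinearIndependent K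
      (fun q : Σ i : Fin k, Fin (a i) => homogeneousComponent 1 (l q.1 q.2)))
    (c : Fin k → ℕ) (f : Fin k → MvPolynomial (Fin N) K)
    (hf : ∀ i, ∃ g : MvPolynomial (Fin (a i)) K, g.totalDegree ≤ c i ∧
      f i = (∏ j ∈ Finset.univ.filter (fun j => j < i),
                (l j ⟨0, ha j⟩) ^ (c j + 1))
            * aeval (l i) g)
    (hsum : ∑ i, f i = 0) :
    ∀ i, f i = 0 := by
  choose g hg hfg using hf
  obtain ⟨φ, hφ⟩ := exists_algHom_apply_eq_X
    (l := fun q : Σ i : Fin k, Fin (a i) => l q.1 q.2) (fun q => hdeg q.1 q.2) hind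
  let s (i : Fin k) : (Σ i : Fin k, Fin (a i)) →₀ ℕ :=
    ∑ j ∈ Finset.univ.filter (fun j => j < i), Finsupp.single ⟨j, ⟨0, ha j⟩⟩ (c j + 1)
  let G (i : Fin k) : MvPolynomial (Σ i : Fin k, Fin (a i)) K :=
    monomial (s i) 1 * rename (Sigma.mk i) (g i)
  have hφf (i : Fin k) : φ (f i) = G i := by
    have hcomp : φ (aeval (l i) (g i)) = rename (Sigma.mk i) (g i) := by
      rw [← AlgHom.comp_apply, comp_aeval, rename_eq_aeval]
      congr 2
      exact funext fun j => hφ ⟨i, j⟩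
    rw [hfg, map_mul, hcomp, map_prod]
    simp only [G, s, monomial_sum_one, map_pow]
    congr 1
    refine Finset.prod_congr rfl fun j _ => ?_
    rw [hφ ⟨j, ⟨0, ha j⟩⟩, X_pow_eq_monomial]
  have hdisj {i j : Fin k} (hij : i < j) : Disjoint (G i).support (G j).support := by
    refine disjoint_support_monomial_mul ⟨i, ⟨0, ha i⟩⟩ ?_
    have hi : s i ⟨i, ⟨0, ha i⟩⟩ = 0 := by
      rw [Finsupp.finsetSum_apply]
      refine Finset.sum_eq_zero fun j hj => Finsupp.single_eq_of_ne fun h => ?_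
      exact (Finset.mem_filter.mp hj).2.ne' (congrArg Sigma.fst h)
    have hj : c i + 1 ≤ s j ⟨i, ⟨0, ha i⟩⟩ := by
      rw [Finsupp.finsetSum_apply]
      refine le_trans ?_ (Finset.single_le_sum (fun _ _ => Nat.zero_le _)
        (Finset.mem_filter.mpr ⟨Finset.mem_univ i, hij⟩))
      rw [Finsupp.single_eq_same]
    have hdegree : (rename (Sigma.mk (β := fun i => Fin (a i)) i) (g i)).totalDegree ≤ c i :=
      (totalDegree_rename_le _ _).trans (hg i)
    omega
  have hG : ∑ i, G i = 0 := by
    rw [← map_zero φ, ← hsum, map_sum]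
    exact (Finset.sum_congr rfl fun i _ => hφf i).symm
  intro i
  have hGi := eq_zero_of_sum_eq_zero_of_disjoint_support
    (fun i j hij => hij.lt_or_gt.elim hdisj fun h => (hdisj h).symm) hG i
  have hgi : g i = 0 := by
    refine rename_injective (Sigma.mk (β := fun i => Fin (a i)) i) sigma_mk_injective ?_
    rw [map_zero]
    exact (mul_eq_zero.mp hGi).resolve_left (by simp)
  rw [hfg, hgi, map_zero, mul_zero]
end
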